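/- Let H be an infinite-dimensional complex Hilbert space. For every self-adjoint bounded operator x on H there exist a positive integer n and orthogonal projections P_1,…,P_n, Q_1,…,Q_n on H such that x = ∑_{i=1}^n Q_i P_i. -/

import Mathlib

open scoped ComplexStarModule

/-- The additive monoid of finite sums of products of two projections. -/
def projectionProductSums (A : Type*) [NonUnitalSemiring A] [Star A] : AddSubmonoid A :=
  AddSubmonoid.closure {z | ∃ q p : A, IsStarProjection q ∧ IsStarProjection p ∧ q * p = z}

/-- A pair of isometries with complementary ranges. -/
structure IsCuntzPair {A : Type*} [Semiring A] [StarRing A] (s t : A) : Prop where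
  star_left_mul_left : star s * s = 1
  star_right_mul_right : star t * t = 1
  star_left_mul_right : star s * t = 0
  star_right_mul_left : star t * s = 0
  add_eq_one : s * star s + t * star t = 1

/-- The element whose matrix with respect to the decomposition given by a pair of isometries `s`,
`t` is `!![a, b; c, d]`. -/
def blockOp {A : Type*} [Semiring A] [StarRing A] (s t a b c d : A) : A :=
  s * (a * star s) + s * (b * star t) + t * (c * star s) + t * (d * star t)

section Algebra

variable {A : Type*} [Ring A] [StarRing A]

lemma mul_mem_projectionProductSums {q p : A} (hq : IsStarProjection q)
    (hp : IsStarProjection p) : q * p ∈ projectionProductSums A :=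
  AddSubmonoid.subset_closure ⟨q, p, hq, hp, rfl⟩

lemma conj_mem_projectionProductSums {v z : A} (hv : star v * v = 1)
    (hz : z ∈ projectionProductSums A) : v * z * star v ∈ projectionProductSums A := by
  have hv' : ∀ y : A, star v * (v * y) = y := fun y ↦ by rw [← mul_assoc, hv, one_mul]
  have key : ∀ p : A, IsStarProjection p → IsStarProjection (v * p * star v) := fun p hp ↦ by
    have hpp : ∀ y : A, p * (p * y) = p * y := fun y ↦ by
      rw [← mul_assoc, hp.isIdempotentElem.eq]
    refine isStarProjection_iff'.2 ⟨?_, ?_⟩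
    · simp only [mul_assoc, hv', hpp]
    · simp only [star_mul, star_star, hp.isSelfAdjoint.star_eq, mul_assoc]
  induction hz using AddSubmonoid.closure_induction with
  | mem z hz =>
    obtain ⟨q, p, hq, hp, rfl⟩ := hz
    have : v * (q * p) * star v = (v * q * star v) * (v * p * star v) := by
      simp only [mul_assoc, hv']
    rw [this]
    exact mul_mem_projectionProductSums (key q hq) (key p hp)
  | zero => simp [zero_mem]
  | add x y _ _ hx hy =>
    rw [mul_add, add_mul]
    exact add_mem hx hy

variable {s t : A}

lemma star_blockOp (a b c d : A) :
    star (blockOp s t a b c d) = blockOp s t (star a) (star c) (star b) (star d) := by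
  simp only [blockOp, star_add, star_mul, star_star, mul_assoc]
  abel

lemma blockOp_add (a b c d a' b' c' d' : A) :
    blockOp s t a b c d + blockOp s t a' b' c' d' =
      blockOp s t (a + a') (b + b') (c + c') (d + d') := by
  simp only [blockOp, mul_add, add_mul]
  abel

lemma nsmul_blockOp (n : ℕ) (a b c d : A) :
    n • blockOp s t a b c d = blockOp s t (n • a) (n • b) (n • c) (n • d) := by
  simp only [blockOp, smul_add, mul_smul_comm, smul_mul_assoc]

namespace IsCuntzPair

variable (h : IsCuntzPair s t)
include h

lemma blockOp_mul (a b c d a' b' c' d' : A) :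
    blockOp s t a b c d * blockOp s t a' b' c' d' =
      blockOp s t (a * a' + b * c') (a * b' + b * d') (c * a' + d * c') (c * b' + d * d') := by
  have h1 : ∀ y : A, star s * (s * y) = y := fun y ↦ by
    rw [← mul_assoc, h.star_left_mul_left, one_mul]
  have h2 : ∀ y : A, star t * (t * y) = y := fun y ↦ by
    rw [← mul_assoc, h.star_right_mul_right, one_mul]
  have h3 : ∀ y : A, star s * (t * y) = 0 := fun y ↦ by
    rw [← mul_assoc, h.star_left_mul_right, zero_mul]
  have h4 : ∀ y : A, star t * (s * y) = 0 := fun y ↦ by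
    rw [← mul_assoc, h.star_right_mul_left, zero_mul]
  simp only [blockOp, mul_add, add_mul, mul_assoc, h1, h2, h3, h4, mul_zero, add_zero, zero_add]
  abel

lemma blockOp_one : blockOp s t 1 0 0 1 = 1 := by
  simpa [blockOp] using h.add_eq_one

lemma eq_blockOp (x : A) :
    x = blockOp s t (star s * x * s) (star s * x * t) (star t * x * s) (star t * x * t) := by
  have : x = (s * star s + t * star t) * x * (s * star s + t * star t) := by
    rw [h.add_eq_one, one_mul, mul_one]
  nth_rw 1 [this]
  simp only [blockOp, mul_add, add_mul, mul_assoc]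
  abel

lemma isStarProjection_corner : IsStarProjection (blockOp s t 1 0 0 0) := by
  refine isStarProjection_iff'.2 ⟨?_, ?_⟩
  · simp [h.blockOp_mul]
  · simp [star_blockOp]

lemma blockOp_swap_mem {a b c d : A} (hz : blockOp s t a b c d ∈ projectionProductSums A) :
    blockOp s t d c b a ∈ projectionProductSums A := by
  convert conj_mem_projectionProductSums (v := blockOp s t 0 1 1 0) ?_ hz using 1
  · simp [star_blockOp, h.blockOp_mul]
  · simp [star_blockOp, h.blockOp_mul, h.blockOp_one]

variable [Algebra ℂ A]

lemma blockOp_scalar (z : ℂ) : blockOp s t (z • 1) 0 0 (z • 1) = z • (1 : A) := by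
  calc blockOp s t (z • 1) 0 0 (z • 1) = z • (s * star s + t * star t) := by simp [blockOp]
    _ = z • 1 := by rw [h.add_eq_one]

variable [StarModule ℂ A]

lemma isStarProjection_of_unitary {u : A} (hu : u ∈ unitary A) :
    IsStarProjection
      (blockOp s t ((1 / 2 : ℂ) • 1) ((1 / 2 : ℂ) • u) ((1 / 2 : ℂ) • star u)
        ((1 / 2 : ℂ) • 1)) := by
  have h1 := Unitary.star_mul_self_of_mem hu
  have h2 := Unitary.mul_star_self_of_mem hu
  refine isStarProjection_iff'.2 ⟨?_, ?_⟩
  · rw [h.blockOp_mul]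
    congr 1 <;> simp only [smul_mul_smul_comm, h1, h2, mul_one, one_mul] <;> module
  · simp [star_blockOp, star_smul]

lemma blockOp_unitary_mem {u : A} (hu : u ∈ unitary A) :
    blockOp s t (2 • 1) u (star u) 0 ∈ projectionProductSums A := by
  have hp := h.isStarProjection_of_unitary hu
  have hq := h.isStarProjection_corner
  have h1 := add_mem (mul_mem_projectionProductSums hq hp) (mul_mem_projectionProductSums hp hq)
  convert nsmul_mem h1 2 using 1
  rw [h.blockOp_mul, h.blockOp_mul, blockOp_add, nsmul_blockOp]
  congr 1 <;> simp only [mul_one, one_mul, mul_zero, zero_mul, add_zero, zero_add] <;> module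

lemma isStarProjection_of_cos_sin {c w : A} (hc : IsSelfAdjoint c) (hw : IsSelfAdjoint w)
    (hcw : c * w = w * c) (hcw' : c * c + w * w = 1) :
    IsStarProjection
      (blockOp s t ((1 / 2 : ℂ) • (1 + c)) ((1 / 2 : ℂ) • w) ((1 / 2 : ℂ) • w)
        ((1 / 2 : ℂ) • (1 - c))) := by
  have hww : w * w = 1 - c * c := by rw [← hcw']; abel
  refine isStarProjection_iff'.2 ⟨?_, ?_⟩
  · rw [h.blockOp_mul]
    congr 1 <;> simp only [smul_mul_smul_comm, mul_add, add_mul, mul_sub, sub_mul, mul_one,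
      one_mul, hww, hcw] <;> module
  · simp [star_blockOp, star_smul, hc.star_eq, hw.star_eq]

lemma blockOp_one_add_mem {c w : A} (hc : IsSelfAdjoint c) (hw : IsSelfAdjoint w)
    (hcw : c * w = w * c) (hcw' : c * c + w * w = 1) :
    blockOp s t (1 + c) 0 0 0 ∈ projectionProductSums A := by
  have hp := h.isStarProjection_of_cos_sin hc hw hcw hcw'
  have hp' := h.isStarProjection_of_cos_sin hc hw.neg (by simp [hcw]) (by simpa using hcw')
  have hq := h.isStarProjection_corner
  convert add_mem (mul_mem_projectionProductSums hq hp) (mul_mem_projectionProductSums hq hp')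
    using 1
  rw [h.blockOp_mul, h.blockOp_mul, blockOp_add]
  congr 1 <;> simp only [one_mul, zero_mul, add_zero] <;> module

lemma blockOp_indefinite_mem :
    blockOp s t ((224 : ℂ) • 1) 0 0 ((-126 : ℂ) • 1) ∈ projectionProductSums A := by
  have key : ∀ r : ℝ, r * r = 144 / 625 → IsStarProjection
      (blockOp s t ((16 / 25 : ℂ) • 1) ((r : ℂ) • 1) ((r : ℂ) • 1) ((9 / 25 : ℂ) • 1)) := by
    intro r hr
    have hr' : (r : ℂ) * r = 144 / 625 := by
      rw [← Complex.ofReal_mul, hr]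
      norm_num
    refine isStarProjection_iff'.2 ⟨?_, ?_⟩
    · rw [h.blockOp_mul]
      congr 1 <;> simp only [smul_mul_smul_comm, mul_one, hr'] <;> module
    · simp [star_blockOp, star_smul]
  have hp := key (12 / 25) (by norm_num)
  have hq := key (-(12 / 25)) (by norm_num)
  convert nsmul_mem (add_mem (mul_mem_projectionProductSums hq hp)
    (mul_mem_projectionProductSums hp hq)) 625 using 1
  rw [h.blockOp_mul, h.blockOp_mul, blockOp_add, nsmul_blockOp]
  push_cast
  congr 1 <;> simp only [smul_mul_smul_comm, mul_one] <;> module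

lemma neg_scalar_mem : (-28 : ℂ) • (1 : A) ∈ projectionProductSums A := by
  have key : ∀ r : A, star r * r = 1 →
      blockOp s t ((224 : ℂ) • (r * star r)) 0 0 ((-126 : ℂ) • 1) ∈ projectionProductSums A := by
    intro r hr
    convert conj_mem_projectionProductSums (v := blockOp s t r 0 0 1) ?_
      h.blockOp_indefinite_mem using 1
    · simp [star_blockOp, h.blockOp_mul]
    · simp [star_blockOp, h.blockOp_mul, h.blockOp_one, hr]
  have h1 := add_mem (key s h.star_left_mul_left) (key t h.star_right_mul_right)
  rw [blockOp_add, ← smul_add, h.add_eq_one] at h1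
  convert add_mem h1 (h.blockOp_swap_mem h1) using 1
  rw [← h.blockOp_scalar, blockOp_add]
  congr 1 <;> module

end IsCuntzPair

end Algebra

section CStarAlgebra

variable {A : Type*} [CStarAlgebra A]

lemma IsSelfAdjoint.exists_sq_add_sq_eq_one {c : A} (hc : IsSelfAdjoint c) (hc1 : ‖c‖ ≤ 1) :
    ∃ w : A, IsSelfAdjoint w ∧ c * w = w * c ∧ c * c + w * w = 1 ∧
      c + Complex.I • w ∈ unitary A := by
  let _ := CStarAlgebra.spectralOrder A
  let _ := CStarAlgebra.spectralOrderedRing A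
  have hu := hc.self_add_I_smul_cfcSqrt_sub_sq_mem_unitary c hc1
  have hw : IsSelfAdjoint (CFC.sqrt (1 - c ^ 2)) := (CFC.sqrt_nonneg (1 - c ^ 2)).isSelfAdjoint
  generalize CFC.sqrt (1 - c ^ 2) = w at hu hw
  have h1 := Unitary.star_mul_self_of_mem hu
  have h2 := Unitary.mul_star_self_of_mem hu
  have hstar : star (c + Complex.I • w) = c - Complex.I • w := by
    simp [star_smul, hc.star_eq, hw.star_eq, sub_eq_add_neg]
  rw [hstar] at h1 h2
  simp only [mul_add, add_mul, mul_sub, sub_mul, mul_smul_comm, smul_mul_assoc, smul_add,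
    smul_sub, smul_smul, Complex.I_mul_I, neg_one_smul] at h1 h2
  refine ⟨w, hw, ?_, ?_, hu⟩
  · have : (2 * Complex.I) • (c * w) = (2 * Complex.I) • (w * c) := by
      linear_combination (norm := module) h1 - h2
    exact smul_right_injective A (by simp : (2 * Complex.I) ≠ 0) this
  · have : (2 : ℂ) • (c * c + w * w) = (2 : ℂ) • 1 := by
      linear_combination (norm := module) h1 + h2
    exact smul_right_injective A (two_ne_zero) this

namespace IsCuntzPair

variable {s t : A} (h : IsCuntzPair s t)
include h

lemma blockOp_nsmul_add_mem {y : A} (hy : IsSelfAdjoint y) {n : ℕ} (hn : 0 < n) (hyn : ‖y‖ ≤ n) :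
    blockOp s t (n • 1 + y) 0 0 0 ∈ projectionProductSums A := by
  have hn' : (0 : ℝ) < n := by exact_mod_cast hn
  obtain ⟨w, hw, hcw, hcw', -⟩ := IsSelfAdjoint.exists_sq_add_sq_eq_one
    (c := (n : ℝ)⁻¹ • y) ((IsSelfAdjoint.all _).smul hy) (by
      rw [norm_smul, norm_inv, Real.norm_natCast, inv_mul_le_one₀ hn']
      exact hyn)
  convert nsmul_mem (h.blockOp_one_add_mem ((IsSelfAdjoint.all _).smul hy) hw hcw hcw') n using 1
  rw [nsmul_blockOp, smul_add, ← Nat.cast_smul_eq_nsmul ℝ n ((n : ℝ)⁻¹ • y),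
    smul_inv_smul₀ hn'.ne']
  simp

lemma blockOp_offDiag_mem_of_isSelfAdjoint {c : A} (hc : IsSelfAdjoint c) (hc1 : ‖c‖ ≤ 1) {z : ℂ}
    (hz : star z * z = 1) :
    blockOp s t (4 • 1) ((2 * z) • c) (star ((2 * z) • c)) 0 ∈ projectionProductSums A := by
  obtain ⟨w, hw, -, -, hu⟩ := hc.exists_sq_add_sq_eq_one hc1
  have key : ∀ {v : A}, v ∈ unitary A → z • v ∈ unitary A := fun {v} hv ↦ by
    rw [Unitary.mem_iff, star_smul, smul_mul_smul_comm, smul_mul_smul_comm,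
      (Unitary.mem_iff.1 hv).1, (Unitary.mem_iff.1 hv).2, hz, mul_comm, hz]
    simp
  have hu' := Unitary.star_mem hu
  convert add_mem (h.blockOp_unitary_mem (key hu)) (h.blockOp_unitary_mem (key hu')) using 1
  rw [blockOp_add]
  congr 1
  · module
  · simp only [star_add, star_smul, hc.star_eq, hw.star_eq, Complex.star_def, Complex.conj_I]
    module
  · simp only [star_add, star_smul, hc.star_eq, hw.star_eq, Complex.star_def,
      Complex.conj_I, map_mul, map_neg, map_ofNat]
    module
  · simp

lemma blockOp_offDiag_mem (b : A) {n : ℕ} (hn : 0 < n) (hb : ‖b‖ ≤ n) :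
    blockOp s t ((8 * n) • 1) (2 • b) (star (2 • b)) 0 ∈ projectionProductSums A := by
  have hn' : (0 : ℝ) < n := by exact_mod_cast hn
  set b' : A := (n : ℝ)⁻¹ • b with hb'
  have hb1 : ‖b'‖ ≤ 1 := by
    rw [hb', norm_smul, norm_inv, Real.norm_natCast, inv_mul_le_one₀ hn']
    exact hb
  have hnb : n • b' = b := by
    rw [hb', ← Nat.cast_smul_eq_nsmul ℝ n, smul_inv_smul₀ hn'.ne']
  have h1 := h.blockOp_offDiag_mem_of_isSelfAdjoint (ℜ b').2
    ((realPart.norm_le b').trans hb1) (z := 1) (by simp)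
  have h2 := h.blockOp_offDiag_mem_of_isSelfAdjoint (ℑ b').2
    ((imaginaryPart.norm_le b').trans hb1) (z := Complex.I) (by simp)
  have hsum : (2 * 1 : ℂ) • (ℜ b' : A) + (2 * Complex.I) • (ℑ b' : A) = 2 • b' := by
    conv_rhs => rw [← realPart_add_I_smul_imaginaryPart b']
    module
  convert nsmul_mem (add_mem h1 h2) n using 1
  rw [blockOp_add, ← star_add, hsum, nsmul_blockOp, ← star_nsmul, smul_comm n 2 b', hnb]
  congr 1
  · module
  · simp

theorem mem_projectionProductSums_of_isSelfAdjoint {x : A} (hx : IsSelfAdjoint x) :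
    x ∈ projectionProductSums A := by
  set a := star s * x * s with ha
  set b := star s * x * t with hb
  set d := star t * x * t with hd
  have hxb : x = blockOp s t a b (star b) d := by
    rw [hb, star_mul, star_mul, star_star, hx.star_eq, ← mul_assoc]
    exact h.eq_blockOp x
  have haa : IsSelfAdjoint a := by
    simpa [ha] using hx.conjugate' s
  have hdd : IsSelfAdjoint d := by
    simpa [hd] using hx.conjugate' t
  obtain ⟨n, hn⟩ := exists_nat_ge ‖(2 : ℂ)⁻¹ • b‖
  have h1 := h.blockOp_offDiag_mem ((2 : ℂ)⁻¹ • b) n.succ_pos (hn.trans (by simp))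
  have h2b : 2 • ((2 : ℂ)⁻¹ • b) = b := by module
  rw [h2b] at h1
  set a' := a - (8 * n.succ) • (1 : A) with ha'
  have haa' : IsSelfAdjoint a' := haa.sub ((IsSelfAdjoint.all (8 * n.succ)).smul (IsSelfAdjoint.one A))
  obtain ⟨m, hm⟩ := exists_nat_ge (max ‖a'‖ ‖d‖)
  have hm' : (m : ℝ) ≤ (28 * (m + 1) : ℕ) := by
    push_cast
    have : (0 : ℝ) ≤ m := m.cast_nonneg
    linarith
  have h3 := h.blockOp_nsmul_add_mem haa' (n := 28 * (m + 1)) (by omega)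
    ((le_max_left _ _).trans (hm.trans hm'))
  have h4 := h.blockOp_swap_mem <| h.blockOp_nsmul_add_mem hdd (n := 28 * (m + 1)) (by omega)
    ((le_max_right _ _).trans (hm.trans hm'))
  have h5 := nsmul_mem h.neg_scalar_mem (m + 1)
  rw [← h.blockOp_scalar, nsmul_blockOp] at h5
  convert add_mem h5 (add_mem h1 (add_mem h3 h4)) using 1
  rw [hxb]
  simp only [blockOp_add, ha']
  congr 1
  · module
  · simp
  · simp
  · module

end IsCuntzPair

end CStarAlgebra

section HilbertSpace

open ContinuousLinearMap

variable {H : Type*} [NormedAddCommGroup H] [InnerProductSpace ℂ H] [CompleteSpace H]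

lemma HilbertBasis.exists_linearIsometry_comp {ι κ : Type*} (b : HilbertBasis ι ℂ H)
    (f : κ ↪ ι) (e : HilbertBasis κ ℂ H) : ∃ s : H →ₗᵢ[ℂ] H, ∀ k, s (e k) = b (f k) := by
  classical
  have ho : Orthonormal ℂ (b ∘ f) := b.orthonormal.comp f f.injective
  refine ⟨ho.orthogonalFamily.linearIsometry.comp e.repr.toLinearIsometry, fun k ↦ ?_⟩
  simp [e.repr_self, OrthogonalFamily.linearIsometry_apply_single]

lemma exists_isCuntzPair (hinf : ¬ FiniteDimensional ℂ H) :
    ∃ s t : H →L[ℂ] H, IsCuntzPair s t := by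
  obtain ⟨ι, b, -⟩ := exists_hilbertBasis ℂ H
  have hι : Infinite ι := by
    rw [← not_finite_iff_infinite]
    intro hfin
    have := Fintype.ofFinite ι
    exact hinf b.toOrthonormalBasis.toBasis.finiteDimensional_of_finite
  obtain ⟨φ⟩ : Nonempty (ι ⊕ ι ≃ ι) := by
    rw [← Cardinal.eq, Cardinal.mk_sum, Cardinal.lift_id,
      Cardinal.add_eq_self (Cardinal.aleph0_le_mk ι)]
  obtain ⟨s, hs⟩ := b.exists_linearIsometry_comp (Function.Embedding.inl.trans φ.toEmbedding) b
  obtain ⟨t, ht⟩ := b.exists_linearIsometry_comp (Function.Embedding.inr.trans φ.toEmbedding) b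
  have hdense : Dense (Submodule.span ℂ (Set.range b) : Set H) :=
    Submodule.dense_iff_topologicalClosure_eq_top.2 b.dense_span
  have hss : star s.toContinuousLinearMap * s.toContinuousLinearMap = 1 := by
    ext1 x
    refine ext_inner_left ℂ fun y ↦ ?_
    simp [star_eq_adjoint, adjoint_inner_right]
  have htt : star t.toContinuousLinearMap * t.toContinuousLinearMap = 1 := by
    ext1 x
    refine ext_inner_left ℂ fun y ↦ ?_
    simp [star_eq_adjoint, adjoint_inner_right]
  have hst : star s.toContinuousLinearMap * t.toContinuousLinearMap = 0 := by
    refine ContinuousLinearMap.ext_on hdense ?_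
    rintro _ ⟨j, rfl⟩
    classical
    apply b.repr.injective
    ext i
    simp [b.repr_apply_apply, star_eq_adjoint, adjoint_inner_right, hs, ht,
      orthonormal_iff_ite.1 b.orthonormal]
  have hts : star t.toContinuousLinearMap * s.toContinuousLinearMap = 0 := by
    simpa using congrArg star hst
  refine ⟨s.toContinuousLinearMap, t.toContinuousLinearMap, hss, htt, hst, hts, ?_⟩
  refine ContinuousLinearMap.ext_on hdense ?_
  rintro _ ⟨i, rfl⟩
  obtain ⟨j | j, rfl⟩ := φ.surjective i
  · have hj : b (φ (.inl j)) = s.toContinuousLinearMap (b j) := (hs j).symm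
    rw [hj, ← mul_apply_eq_comp, add_mul, mul_assoc, mul_assoc, hss, hts]
    simp
  · have hj : b (φ (.inr j)) = t.toContinuousLinearMap (b j) := (ht j).symm
    rw [hj, ← mul_apply_eq_comp, add_mul, mul_assoc, mul_assoc, hst, htt]
    simp

end HilbertSpace

lemma exists_fin_sum_of_mem_projectionProductSums {A : Type*} [Semiring A] [StarRing A] {x : A}
    (hx : x ∈ projectionProductSums A) :
    ∃ n : ℕ, 0 < n ∧ ∃ P Q : Fin n → A,
      (∀ i, IsStarProjection (P i)) ∧ (∀ i, IsStarProjection (Q i)) ∧ x = ∑ i, Q i * P i := by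
  induction hx using AddSubmonoid.closure_induction with
  | mem z hz =>
    obtain ⟨q, p, hq, hp, rfl⟩ := hz
    exact ⟨1, one_pos, fun _ ↦ p, fun _ ↦ q, fun _ ↦ hp, fun _ ↦ hq, by simp⟩
  | zero => exact ⟨1, one_pos, 0, 0, fun _ ↦ .zero A, fun _ ↦ .zero A, by simp⟩
  | add x y _ _ hx hy =>
    obtain ⟨n, hn, P, Q, hP, hQ, rfl⟩ := hx
    obtain ⟨m, -, P', Q', hP', hQ', rfl⟩ := hy
    refine ⟨n + m, by omega, Fin.append P P', Fin.append Q Q', fun i ↦ ?_, fun i ↦ ?_, ?_⟩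
    · induction i using Fin.addCases <;> simp [hP, hP']
    · induction i using Fin.addCases <;> simp [hQ, hQ']
    · simp [Fin.sum_univ_add]

/-- (Bikchentaev) Every self-adjoint bounded operator on an
infinite-dimensional complex Hilbert space is a finite sum of compositions of pairs of
orthogonal projections. -/
theorem selfadjoint_is_sum_of_compositions
    {H : Type*} [NormedAddCommGroup H] [InnerProductSpace ℂ H] [CompleteSpace H]
    (hinf : ¬ FiniteDimensional ℂ H)
    (x : H →L[ℂ] H) (hx : ContinuousLinearMap.adjoint x = x) :
    ∃ (n : ℕ), 0 < n ∧ ∃ P Q : Fin n → H →L[ℂ] H,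
      (∀ i, ContinuousLinearMap.adjoint (P i) = P i ∧ P i ∘L P i = P i) ∧
      (∀ i, ContinuousLinearMap.adjoint (Q i) = Q i ∧ Q i ∘L Q i = Q i) ∧
      x = ∑ i, Q i ∘L P i := by
  obtain ⟨s, t, h⟩ := exists_isCuntzPair hinf
  obtain ⟨n, hn, P, Q, hP, hQ, hsum⟩ := exists_fin_sum_of_mem_projectionProductSums
    (h.mem_projectionProductSums_of_isSelfAdjoint (x := x) hx)
  exact ⟨n, hn, P, Q, fun i ↦ ⟨(hP i).isSelfAdjoint, (hP i).isIdempotentElem⟩,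
    fun i ↦ ⟨(hQ i).isSelfAdjoint, (hQ i).isIdempotentElem⟩, hsum⟩
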